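/- Let r ≥ 3 be an integer and let G be an n-vertex K_{r+1}-free simple graph with (3r-2)·δ(G) + Δ(G) > (3r-4)·n. If u is a vertex of G with deg(u) = Δ(G), then the subgraph of G induced on the neighborhood N(u) is (r-1)-partite. -/

import Mathlib

namespace SimpleGraph

variable {V : Type*} {G : SimpleGraph V}

/-- In a `K_{n+1}`-free graph every neighborhood is `K_n`-free. -/
theorem CliqueFree.induce_neighborSet {n : ℕ} (h : G.CliqueFree (n + 1)) (u : V) :
    (G.induce (G.neighborSet u)).CliqueFree n := by
  classical
  rw [cliqueFree_induce_iff]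
  intro s hs hc
  exact h _ (hc.insert fun b hb ↦ hs hb)

/-- Passing to the subgraph induced on `s` lowers degrees by at most `|V| - |s|`. -/
theorem degree_add_card_le_degree_induce_add_card [Fintype V] [DecidableRel G.Adj]
    (s : Set V) [DecidablePred (· ∈ s)] (v : s) :
    G.degree v + Fintype.card s ≤ (G.induce s).degree v + Fintype.card V := by
  classical
  rw [← card_neighborFinset_eq_degree, ← card_neighborFinset_eq_degree,
    ← Finset.card_map (Function.Embedding.subtype (· ∈ s)), map_neighborFinset_induce,
    ← Set.toFinset_card, ← Finset.card_union_add_card_inter, add_comm]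
  gcongr
  exact Finset.card_le_univ _

end SimpleGraph

/-- Let `r ≥ 3` and let `G` be an `n`-vertex `K_{r+1}`-free simple graph with
`(3r-2)·δ(G) + Δ(G) > (3r-4)·n`. If `u` is a vertex with `deg(u) = Δ(G)`, then the
subgraph induced on the neighborhood `N(u)` is `(r-1)`-partite. -/
theorem stmt_12 {V : Type*} [Fintype V] (r : ℕ) (hr : 3 ≤ r)
    (G : SimpleGraph V) [DecidableRel G.Adj]
    (hfree : G.CliqueFree (r + 1))
    (hdeg : (3 * r - 4) * Fintype.card V < (3 * r - 2) * G.minDegree + G.maxDegree)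
    (u : V) (hu : G.degree u = G.maxDegree) :
    (G.induce (G.neighborSet u)).Colorable (r - 1) := by
  classical
  obtain ⟨k, rfl⟩ : ∃ k, r = k + 3 := ⟨r - 3, by omega⟩
  cases isEmpty_or_nonempty (G.neighborSet u)
  · exact SimpleGraph.Colorable.of_isEmpty _
  refine SimpleGraph.colorable_of_cliqueFree_lt_minDegree (hfree.induce_neighborSet u) ?_
  obtain ⟨v, hv⟩ := (G.induce (G.neighborSet u)).exists_minimal_degree_vertex
  have hind := G.degree_add_card_le_degree_induce_add_card (G.neighborSet u) v
  have hδv := G.minDegree_le_degree v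
  have hδ := G.minDegree_le_degree u
  rw [← hv, G.card_neighborSet_eq_degree] at hind
  rw [G.card_neighborSet_eq_degree, Nat.div_lt_iff_lt_mul (by omega)]
  rw [← hu] at hdeg
  rw [show 3 * (k + 3) - 4 = 3 * k + 5 by omega,
    show 3 * (k + 3) - 2 = 3 * k + 7 by omega] at hdeg
  rw [show 3 * (k + 3 - 1) - 4 = 3 * k + 2 by omega,
    show 3 * (k + 3 - 1) - 1 = 3 * k + 5 by omega]
  nlinarith
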